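/- Let l, m, n be positive integers such that w = l+m+n is odd. Then for all sufficiently large primes p: −H_{p−1}(l,m,n) ≡ H^⋆_{p−1}(l,m,n) ≡ [ (−1)^l · C(w,l) − (−1)^n · C(w,n) ] · B_{p−w}/(2w) (mod p), where C(w,k) is the binomial coefficient. -/

import Mathlib

open scoped BigOperators

/-- Alternating multiple harmonic sum `H_n(𝐬)` where `𝐬` is a list of pairs
`(sⱼ, εⱼ)` (exponent, sign):
`H_n(𝐬) = Σ_{n ≥ k₁ > ⋯ > k_d ≥ 1} Π εⱼ^{kⱼ} / kⱼ^{sⱼ}`. -/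
def AMHS : ℕ → List (ℕ × ℚ) → ℚ
  | _, [] => 1
  | n, (s, ε) :: t => ∑ k ∈ Finset.Icc 1 n, ε ^ k / (k : ℚ) ^ s * AMHS (k - 1) t

/-- Alternating multiple harmonic star sum `H⋆_n(𝐬)` (indices weakly decreasing). -/
def AMHSstar : ℕ → List (ℕ × ℚ) → ℚ
  | _, [] => 1
  | n, (s, ε) :: t => ∑ k ∈ Finset.Icc 1 n, ε ^ k / (k : ℚ) ^ s * AMHSstar k t

/-- A list of pairs is a signed composition: positive exponents, signs `±1`. -/
def IsSignedComp (l : List (ℕ × ℚ)) : Prop := ∀ x ∈ l, 0 < x.1 ∧ (x.2 = 1 ∨ x.2 = -1)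

/-- `a ≡ b (mod p^ℓ)` for rationals: the `p`-adic valuation of `a - b` is at least `ℓ`. -/
def RatModEq (p ℓ : ℕ) (a b : ℚ) : Prop := a = b ∨ (ℓ : ℤ) ≤ padicValRat p (a - b)

/-- View a composition of positive integers as a signed composition with all signs `+1`. -/
def posComp (l : List ℕ) : List (ℕ × ℚ) := l.map (fun s => (s, 1))


open Finset

/-- `q` is a `p`-integral rational with residue `z`. -/
def Red (p : ℕ) [Fact p.Prime] (q : ℚ) (z : ZMod p) : Prop :=
  ∃ x : ℤ_[p], (x : ℚ_[p]) = (q : ℚ_[p]) ∧ PadicInt.toZMod x = z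

section red
variable {p : ℕ} [Fact p.Prime]

lemma Red.add {q q' : ℚ} {z z' : ZMod p} (h : Red p q z) (h' : Red p q' z') :
    Red p (q + q') (z + z') := by
  obtain ⟨x, hx, rfl⟩ := h
  obtain ⟨y, hy, rfl⟩ := h'
  exact ⟨x + y, by push_cast; rw [hx, hy], map_add _ _ _⟩

lemma Red.mul {q q' : ℚ} {z z' : ZMod p} (h : Red p q z) (h' : Red p q' z') :
    Red p (q * q') (z * z') := by
  obtain ⟨x, hx, rfl⟩ := h
  obtain ⟨y, hy, rfl⟩ := h'
  exact ⟨x * y, by push_cast; rw [hx, hy], map_mul _ _ _⟩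

lemma Red.neg {q : ℚ} {z : ZMod p} (h : Red p q z) : Red p (-q) (-z) := by
  obtain ⟨x, hx, rfl⟩ := h
  exact ⟨-x, by push_cast; rw [hx], map_neg _ _⟩

lemma Red.sub {q q' : ℚ} {z z' : ZMod p} (h : Red p q z) (h' : Red p q' z') :
    Red p (q - q') (z - z') := by
  rw [sub_eq_add_neg, sub_eq_add_neg]; exact h.add h'.neg

lemma Red.natCast (n : ℕ) : Red p (n : ℚ) (n : ZMod p) :=
  ⟨n, by simp, by simp⟩

lemma Red.one : Red p 1 1 := by simpa using Red.natCast (p := p) 1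

lemma Red.zero : Red p 0 0 := by simpa using Red.natCast (p := p) 0

lemma Red.pow {q : ℚ} {z : ZMod p} (h : Red p q z) (n : ℕ) : Red p (q ^ n) (z ^ n) := by
  induction n with
  | zero => simpa using Red.one
  | succ n ih => rw [pow_succ, pow_succ]; exact ih.mul h

lemma Red.sum {ι : Type*} (s : Finset ι) {f : ι → ℚ} {g : ι → ZMod p}
    (h : ∀ i ∈ s, Red p (f i) (g i)) : Red p (∑ i ∈ s, f i) (∑ i ∈ s, g i) := by
  classical
  induction s using Finset.induction_on with
  | empty => simpa using Red.zero
  | insert a s ha ih =>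
    rw [sum_insert ha, sum_insert ha]
    exact (h a (mem_insert_self _ _)).add (ih fun i hi => h i (mem_insert_of_mem hi))

lemma Red.inv {q : ℚ} {z : ZMod p} (h : Red p q z) (hz : z ≠ 0) : Red p q⁻¹ z⁻¹ := by
  obtain ⟨x, hx, rfl⟩ := h
  have hu : IsUnit x := by
    by_contra hn
    apply hz
    have : x ∈ RingHom.ker (PadicInt.toZMod : ℤ_[p] →+* ZMod p) := by
      rw [PadicInt.ker_toZMod]
      exact (IsLocalRing.mem_maximalIdeal x).2 hn
    exact this
  obtain ⟨u, rfl⟩ := hu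
  refine ⟨((u⁻¹ : ℤ_[p]ˣ) : ℤ_[p]), ?_, ?_⟩
  · push_cast
    rw [← hx]
    apply eq_inv_of_mul_eq_one_left
    rw [← PadicInt.coe_mul, Units.inv_mul, PadicInt.coe_one]
  · apply eq_inv_of_mul_eq_one_left
    rw [← map_mul, Units.inv_mul, map_one]

lemma Red.modEq {q q' : ℚ} {z : ZMod p} (h : Red p q z) (h' : Red p q' z) :
    RatModEq p 1 q q' := by
  obtain ⟨x, hx, hx'⟩ := h.sub h'
  by_cases hq : q = q'
  · exact Or.inl hq
  right
  have hq' : q - q' ≠ 0 := sub_ne_zero.2 hq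
  have hm : x ∈ RingHom.ker (PadicInt.toZMod : ℤ_[p] →+* ZMod p) := by
    rw [RingHom.mem_ker, hx', sub_self]
  rw [PadicInt.ker_toZMod, IsLocalRing.mem_maximalIdeal, PadicInt.mem_nonunits,
    PadicInt.norm_def, hx, Padic.eq_padicNorm, padicNorm.eq_zpow_of_nonzero hq'] at hm
  by_contra hv
  push Not at hv
  have h1 : padicValRat p (q - q') ≤ 0 := by
    have : padicValRat p (q - q') < 1 := by exact_mod_cast hv
    omega
  have h2 : (1 : ℚ) ≤ (p : ℚ) ^ (-padicValRat p (q - q')) :=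
    one_le_zpow₀ (by exact_mod_cast (Fact.out : p.Prime).one_le) (by omega)
  have h3 : ((p : ℚ) ^ (-padicValRat p (q - q'))) < 1 := by exact_mod_cast hm
  linarith

lemma natCast_ne_zero_of_lt {k : ℕ} (h0 : 0 < k) (h : k < p) : (k : ZMod p) ≠ 0 := by
  rw [Ne, ZMod.natCast_eq_zero_iff]
  exact Nat.not_dvd_of_pos_of_lt h0 h

/-- The residue of `1 / k ^ a`. -/
def FF (p : ℕ) [Fact p.Prime] (a k : ℕ) : ZMod p := ((k : ZMod p)⁻¹) ^ a

lemma red_FF (a k : ℕ) (h0 : 0 < k) (h : k < p) : Red p ((1 : ℚ) ^ k / (k : ℚ) ^ a) (FF p a k) := by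
  rw [one_pow, one_div, ← inv_pow]
  exact ((Red.natCast k).inv (natCast_ne_zero_of_lt h0 h)).pow a

lemma FF_mul (a b k : ℕ) : FF p a k * FF p b k = FF p (a + b) k := (pow_add _ _ _).symm

lemma FF_eq_pow {a b k : ℕ} (h0 : 0 < k) (h : k < p) (hab : a + b = p - 1) :
    FF p a k = (k : ZMod p) ^ b := by
  have hk := natCast_ne_zero_of_lt (p := p) h0 h
  have := ZMod.pow_card_sub_one_eq_one hk
  rw [← hab, pow_add] at this
  unfold FF
  rw [inv_pow]
  exact inv_eq_of_mul_eq_one_right this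

lemma FF_neg {a k : ℕ} (h : k ≤ p) : FF p a (p - k) = (-1) ^ a * FF p a k := by
  unfold FF
  rw [Nat.cast_sub h, ZMod.natCast_self, zero_sub, inv_neg, neg_pow]

lemma sum_pow_Icc {e : ℕ} (h0 : 0 < e) (h : e < p - 1) :
    ∑ i ∈ Icc 1 (p - 1), (i : ZMod p) ^ e = 0 := by
  have hp : p.Prime := Fact.out
  have := FiniteField.sum_pow_lt_card_sub_one (K := ZMod p) e (by rwa [ZMod.card])
  rw [← this]
  symm
  rw [← Finset.sum_erase univ (a := (0 : ZMod p)) (by simp [h0.ne'])]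
  refine Finset.sum_nbij' (fun x => x.val) (fun i => (i : ZMod p)) ?_ ?_ ?_ ?_ ?_
  · intro x hx
    have h1 := ZMod.val_lt x
    have h2 : x.val ≠ 0 := by
      rw [Ne, ZMod.val_eq_zero]; exact (mem_erase.1 hx).1
    rw [mem_Icc]; omega
  · intro i hi
    rw [mem_Icc] at hi
    exact mem_erase.2 ⟨natCast_ne_zero_of_lt (by omega) (by omega), mem_univ _⟩
  · intro x _; simp
  · intro i hi
    rw [mem_Icc] at hi
    exact ZMod.val_cast_of_lt (by omega)
  · intro x _; simp

lemma sum_FF_Icc {a : ℕ} (h0 : 0 < a) (h : a < p - 1) :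
    ∑ i ∈ Icc 1 (p - 1), FF p a i = 0 := by
  rw [← sum_pow_Icc (p := p) (e := p - 1 - a) (by omega) (by omega)]
  refine sum_congr rfl fun i hi => ?_
  rw [mem_Icc] at hi
  exact FF_eq_pow (by omega) (by omega) (by omega)

lemma sum_FF_mul_pow {a e : ℕ} (ha0 : 0 < a) (ha : a < p - 1) (he0 : 0 < e) (he : e < p) :
    ∑ i ∈ Icc 1 (p - 1), FF p a i * (i : ZMod p) ^ e = if e = a then -1 else 0 := by
  have hp : p.Prime := Fact.out
  have key : ∀ i ∈ Icc 1 (p - 1), (i : ZMod p) ≠ 0 := fun i hi => by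
    rw [mem_Icc] at hi
    exact natCast_ne_zero_of_lt (by omega) (by omega)
  rcases lt_trichotomy e a with h | h | h
  · rw [if_neg h.ne, ← sum_FF_Icc (p := p) (a := a - e) (by omega) (by omega)]
    refine sum_congr rfl fun i hi => ?_
    obtain ⟨c, rfl⟩ := Nat.exists_eq_add_of_lt h
    have : e + c + 1 - e = c + 1 := by omega
    rw [this, add_assoc, ← FF_mul]
    unfold FF
    rw [mul_right_comm, ← mul_pow, inv_mul_cancel₀ (key i hi), one_pow, one_mul]
  · subst h
    rw [if_pos rfl]
    rw [sum_congr rfl (g := fun _ => (1 : ZMod p))]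
    · simp [Nat.cast_sub hp.one_le]
    · intro i hi
      unfold FF
      rw [← mul_pow, inv_mul_cancel₀ (key i hi), one_pow]
  · rw [if_neg h.ne', ← sum_pow_Icc (p := p) (e := e - a) (by omega) (by omega)]
    refine sum_congr rfl fun i hi => ?_
    obtain ⟨c, rfl⟩ := Nat.exists_eq_add_of_lt h
    have : a + c + 1 - a = c + 1 := by omega
    rw [this, add_assoc, pow_add]
    unfold FF
    rw [← mul_assoc, ← mul_pow, inv_mul_cancel₀ (key i hi), one_pow, one_mul]

lemma exists_red_bernoulli (n : ℕ) (hn : n + 1 < p) : ∃ z, Red p (bernoulli n) z := by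
  induction n using Nat.strong_induction_on with
  | _ n ih =>
    have h := sum_bernoulli (n + 1)
    rw [sum_range_succ] at h
    have hne : ((n + 1 : ℕ) : ℚ) ≠ 0 := by positivity
    have hB : bernoulli n = (((n + 1 : ℕ) : ℚ))⁻¹ * ((if n + 1 = 1 then 1 else 0) -
        ∑ k ∈ range n, ((n + 1).choose k : ℚ) * bernoulli k) := by
      rw [← h, Nat.choose_succ_self_right]
      field_simp
      ring
    choose! f hf using ih
    rw [hB]
    have h1 := (Red.natCast (p := p) (n + 1)).inv (natCast_ne_zero_of_lt (by omega) hn)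
    have h2 : Red p (if n + 1 = 1 then 1 else 0) (if n + 1 = 1 then 1 else 0) := by
      split_ifs
      · exact Red.one
      · exact Red.zero
    exact ⟨_, h1.mul (h2.sub (Red.sum (range n) (g := fun k => ((n + 1).choose k : ZMod p) * f k)
      fun k hk => (Red.natCast _).mul (hf k (mem_range.1 hk) (by have := mem_range.1 hk; omega))))⟩

lemma Red.unique {q : ℚ} {z z' : ZMod p} (h : Red p q z) (h' : Red p q z') : z = z' := by
  obtain ⟨x, hx, rfl⟩ := h
  obtain ⟨y, hy, rfl⟩ := h'
  have : x = y := by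
    apply Subtype.ext
    exact hx.trans hy.symm
  rw [this]

lemma choose_modp (b a : ℕ) (h : a + b + 1 ≤ p) :
    ((p - 1 - b).choose a : ZMod p) = (-1) ^ a * ((a + b).choose a : ZMod p) := by
  induction a with
  | zero => simp
  | succ a ih =>
    have ih := ih (by omega)
    have hne : ((a + 1 : ℕ) : ZMod p) ≠ 0 := natCast_ne_zero_of_lt (by omega) (by omega)
    apply mul_right_cancel₀ hne
    have e1 := congrArg (Nat.cast : ℕ → ZMod p) (Nat.choose_succ_right_eq (p - 1 - b) a)
    have e2 := congrArg (Nat.cast : ℕ → ZMod p) (Nat.add_one_mul_choose_eq (a + b) a)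
    have e3 : p - 1 - b - a = p - (a + b + 1) := by omega
    rw [e3] at e1
    rw [Nat.cast_mul, Nat.cast_mul, Nat.cast_sub (by omega), ZMod.natCast_self, ih] at e1
    rw [Nat.cast_mul, Nat.cast_mul] at e2
    rw [e1, show a + 1 + b = a + b + 1 by omega, pow_succ]
    linear_combination (-(-1) ^ a) * e2

/-- depth two sums -/
def DD (p : ℕ) [Fact p.Prime] (a b : ℕ) : ZMod p :=
  ∑ i ∈ Icc 1 (p - 1), FF p a i * ∑ j ∈ Icc 1 (i - 1), FF p b j

lemma inner_sum_FF {b i : ℕ} {β : ℕ → ZMod p} (hβ : ∀ t, t + 1 < p → Red p (bernoulli t) (β t))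
    (hb : 0 < b) (hbp : b + 1 < p) (hi : 0 < i) (hip : i < p) :
    ∑ j ∈ Icc 1 (i - 1), FF p b j =
      ∑ t ∈ range (p - b), β t * ((p - b).choose t : ZMod p) * (i : ZMod p) ^ (p - b - t)
        * ((p - b : ℕ) : ZMod p)⁻¹ := by
  have h := sum_range_pow i (p - 1 - b)
  have e : p - 1 - b + 1 = p - b := by omega
  have e' : ((p - 1 - b : ℕ) : ℚ) + 1 = ((p - b : ℕ) : ℚ) := by rw [← e]; push_cast; rfl
  rw [e, e'] at h
  have hne : ((p - b : ℕ) : ZMod p) ≠ 0 := natCast_ne_zero_of_lt (by omega) (by omega)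
  have r1 : Red p (∑ k ∈ range i, (k : ℚ) ^ (p - 1 - b))
      (∑ k ∈ range i, (k : ZMod p) ^ (p - 1 - b)) :=
    Red.sum _ fun k _ => (Red.natCast k).pow _
  rw [h] at r1
  have r2 := Red.sum (p := p) (range (p - b))
    (f := fun t => bernoulli t * ((p - b).choose t : ℚ) * (i : ℚ) ^ (p - b - t) / ((p - b : ℕ) : ℚ))
    (g := fun t => β t * ((p - b).choose t : ZMod p) * (i : ZMod p) ^ (p - b - t)
        * ((p - b : ℕ) : ZMod p)⁻¹) (fun t ht => by
      rw [mem_range] at ht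
      rw [div_eq_mul_inv]
      exact (((hβ t (by omega)).mul (Red.natCast _)).mul ((Red.natCast _).pow _)).mul
        ((Red.natCast _).inv hne))
  rw [← r1.unique r2]
  have : range i = insert 0 (Icc 1 (i - 1)) := by
    ext x; simp only [mem_range, mem_insert, mem_Icc]; omega
  rw [this, sum_insert (by simp), Nat.cast_zero, zero_pow (by omega), zero_add]
  refine sum_congr rfl fun j hj => ?_
  rw [mem_Icc] at hj
  exact FF_eq_pow (by omega) (by omega) (by omega)

lemma DD_eq {a b : ℕ} {β : ℕ → ZMod p} (hβ : ∀ t, t + 1 < p → Red p (bernoulli t) (β t))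
    (ha : 0 < a) (hb : 0 < b) (hp : a + b + 1 < p) :
    ((a + b : ℕ) : ZMod p) * DD p a b = (-1) ^ a * ((a + b).choose a : ZMod p) * β (p - (a + b)) := by
  have hne : ((b : ℕ) : ZMod p) ≠ 0 := natCast_ne_zero_of_lt (by omega) (by omega)
  have h1 : DD p a b = ∑ t ∈ range (p - b), β t * ((p - b).choose t : ZMod p)
      * ((p - b : ℕ) : ZMod p)⁻¹ * (if p - b - t = a then -1 else 0) := by
    unfold DD
    have hin : ∀ i ∈ Icc 1 (p - 1), FF p a i * ∑ j ∈ Icc 1 (i - 1), FF p b j =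
        ∑ t ∈ range (p - b), FF p a i * (β t * ((p - b).choose t : ZMod p) *
          (i : ZMod p) ^ (p - b - t) * ((p - b : ℕ) : ZMod p)⁻¹) := fun i hi => by
      rw [mem_Icc] at hi
      rw [inner_sum_FF hβ hb (by omega) (by omega) (by omega), mul_sum]
    rw [sum_congr rfl hin]
    rw [sum_comm]
    refine sum_congr rfl fun t ht => ?_
    rw [mem_range] at ht
    rw [← sum_FF_mul_pow ha (by omega) (by omega) (by omega), mul_sum]
    refine sum_congr rfl fun i _ => ?_
    ring
  rw [Finset.sum_eq_single_of_mem (p - (a + b)) (by rw [mem_range]; omega)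
    (fun t ht hta => by
      rw [mem_range] at ht
      rw [if_neg (by omega), mul_zero]), if_pos (by omega)] at h1
  have e1 : (p - b).choose (p - (a + b)) = (p - 1 - (b - 1)).choose a := by
    rw [show p - 1 - (b - 1) = p - b by omega]
    exact Nat.choose_symm_of_eq_add (by omega)
  rw [e1, choose_modp _ _ (by omega), Nat.cast_sub (by omega), ZMod.natCast_self, zero_sub] at h1
  have e2 := congrArg (Nat.cast : ℕ → ZMod p) (Nat.choose_mul_succ_eq (a + (b - 1)) a)
  rw [show a + (b - 1) + 1 = a + b by omega, show a + b - a = b by omega, Nat.cast_mul,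
    Nat.cast_mul] at e2
  rw [h1, inv_neg]
  field_simp
  linear_combination β (p - (a + b)) * e2

/-- depth three sums, organised around the middle index -/
def TT (p : ℕ) [Fact p.Prime] (l m n : ℕ) : ZMod p :=
  ∑ j ∈ Icc 1 (p - 1), FF p m j * (∑ i ∈ Icc (j + 1) (p - 1), FF p l i) *
    ∑ k ∈ Icc 1 (j - 1), FF p n k

/-- the star version -/
def SS (p : ℕ) [Fact p.Prime] (l m n : ℕ) : ZMod p :=
  ∑ j ∈ Icc 1 (p - 1), FF p m j * (∑ i ∈ Icc j (p - 1), FF p l i) *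
    ∑ k ∈ Icc 1 j, FF p n k

lemma red_T (l m n : ℕ) :
    Red p (AMHS (p - 1) [(l, (1 : ℚ)), (m, (1 : ℚ)), (n, (1 : ℚ))]) (TT p l m n) := by
  have e : TT p l m n = ∑ i ∈ Icc 1 (p - 1), FF p l i * ∑ j ∈ Icc 1 (i - 1), FF p m j *
      ∑ k ∈ Icc 1 (j - 1), FF p n k * 1 := by
    unfold TT
    have hin : ∀ j ∈ Icc 1 (p - 1), FF p m j * (∑ i ∈ Icc (j + 1) (p - 1), FF p l i) *
        ∑ k ∈ Icc 1 (j - 1), FF p n k = ∑ i ∈ Icc (j + 1) (p - 1), FF p l i * (FF p m j *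
        ∑ k ∈ Icc 1 (j - 1), FF p n k) := fun j _ => by
      rw [← sum_mul]; ring
    rw [sum_congr rfl hin]
    rw [sum_comm' (s' := fun i => Icc 1 (i - 1)) (t' := Icc 1 (p - 1))
      (by intro x y; simp only [mem_Icc]; omega)]
    simp only [mul_sum, mul_one]
  rw [e]
  simp only [AMHS]
  refine Red.sum _ fun i hi => ?_
  rw [mem_Icc] at hi
  refine (red_FF l i (by omega) (by omega)).mul (Red.sum _ fun j hj => ?_)
  rw [mem_Icc] at hj
  refine (red_FF m j (by omega) (by omega)).mul (Red.sum _ fun k hk => ?_)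
  rw [mem_Icc] at hk
  exact (red_FF n k (by omega) (by omega)).mul Red.one

lemma red_S (l m n : ℕ) :
    Red p (AMHSstar (p - 1) [(l, (1 : ℚ)), (m, (1 : ℚ)), (n, (1 : ℚ))]) (SS p l m n) := by
  have e : SS p l m n = ∑ i ∈ Icc 1 (p - 1), FF p l i * ∑ j ∈ Icc 1 i, FF p m j *
      ∑ k ∈ Icc 1 j, FF p n k * 1 := by
    unfold SS
    have hin : ∀ j ∈ Icc 1 (p - 1), FF p m j * (∑ i ∈ Icc j (p - 1), FF p l i) *
        ∑ k ∈ Icc 1 j, FF p n k = ∑ i ∈ Icc j (p - 1), FF p l i * (FF p m j *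
        ∑ k ∈ Icc 1 j, FF p n k) := fun j _ => by
      rw [← sum_mul]; ring
    rw [sum_congr rfl hin]
    rw [sum_comm' (s' := fun i => Icc 1 i) (t' := Icc 1 (p - 1))
      (by intro x y; simp only [mem_Icc]; omega)]
    simp only [mul_sum, mul_one]
  rw [e]
  simp only [AMHSstar]
  refine Red.sum _ fun i hi => ?_
  rw [mem_Icc] at hi
  refine (red_FF l i (by omega) (by omega)).mul (Red.sum _ fun j hj => ?_)
  rw [mem_Icc] at hj
  refine (red_FF m j (by omega) (by omega)).mul (Red.sum _ fun k hk => ?_)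
  rw [mem_Icc] at hk
  exact (red_FF n k (by omega) (by omega)).mul Red.one

lemma split_left (f : ℕ → ZMod p) {j : ℕ} (h : 1 ≤ j) (h' : j ≤ p - 1) :
    ∑ i ∈ Icc j (p - 1), f i = f j + ∑ i ∈ Icc (j + 1) (p - 1), f i := by
  have : Icc j (p - 1) = insert j (Icc (j + 1) (p - 1)) := by
    ext x; simp only [mem_insert, mem_Icc]; omega
  rw [this, sum_insert (by simp)]

lemma split_right (f : ℕ → ZMod p) {j : ℕ} (h : 1 ≤ j) :
    ∑ i ∈ Icc 1 j, f i = f j + ∑ i ∈ Icc 1 (j - 1), f i := by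
  have : Icc 1 j = insert j (Icc 1 (j - 1)) := by
    ext x; simp only [mem_insert, mem_Icc]; omega
  rw [this, sum_insert (by simp only [mem_Icc]; omega)]

lemma split_all (f : ℕ → ZMod p) {j : ℕ} (h : 1 ≤ j) (h' : j ≤ p - 1) :
    ∑ i ∈ Icc 1 (p - 1), f i = ∑ i ∈ Icc 1 j, f i + ∑ i ∈ Icc (j + 1) (p - 1), f i := by
  rw [← sum_union]
  · congr 1
    ext x; simp only [mem_union, mem_Icc]; omega
  · rw [disjoint_left]
    intro x; simp only [mem_Icc]; omega

lemma S_expand (l m n : ℕ) (hl : 0 < l) (hp : l + m + n + 1 < p) :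
    SS p l m n = TT p l m n + DD p (l + m) n + DD p l (m + n) := by
  have e0 := sum_FF_Icc (p := p) (a := l + m + n) (by omega) (by omega)
  have e1 : DD p l (m + n) = ∑ j ∈ Icc 1 (p - 1), FF p (m + n) j *
      ∑ i ∈ Icc (j + 1) (p - 1), FF p l i := by
    unfold DD
    simp only [mul_sum]
    symm
    rw [sum_comm' (s' := fun i => Icc 1 (i - 1)) (t' := Icc 1 (p - 1))
      (by intro x y; simp only [mem_Icc]; omega)]
    refine sum_congr rfl fun i _ => sum_congr rfl fun j _ => ?_
    ring
  rw [e1, ← add_zero (TT p l m n + _ + _), ← e0]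
  unfold SS TT DD
  simp only [← sum_add_distrib]
  refine sum_congr rfl fun j hj => ?_
  rw [mem_Icc] at hj
  rw [split_left _ hj.1 hj.2, split_right _ hj.1, ← FF_mul (l + m), ← FF_mul l m, ← FF_mul m n]
  ring

lemma S_refl (l m n : ℕ) (hl : 0 < l) (hn : 0 < n) (hp : l + m + n + 1 < p)
    (hw : Odd (l + m + n)) : SS p l m n = - TT p l m n := by
  have z1 := sum_FF_Icc (p := p) (a := l) (by omega) (by omega)
  have z2 := sum_FF_Icc (p := p) (a := n) (by omega) (by omega)
  have key : SS p l m n = ∑ j ∈ Icc 1 (p - 1), FF p m j * (∑ i ∈ Icc 1 (j - 1), FF p l i) *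
      ∑ k ∈ Icc (j + 1) (p - 1), FF p n k := by
    unfold SS
    refine sum_congr rfl fun j hj => ?_
    rw [mem_Icc] at hj
    have y1 := split_all (p := p) (FF p l) hj.1 hj.2
    have y2 := split_all (p := p) (FF p n) hj.1 hj.2
    rw [z1, split_right _ hj.1] at y1
    rw [z2] at y2
    rw [split_left _ hj.1 hj.2]
    linear_combination (-FF p m j * ∑ i ∈ Icc 1 j, FF p n i) * y1 +
      (FF p m j * ∑ i ∈ Icc 1 (j - 1), FF p l i) * y2
  have r1 : ∀ j, 1 ≤ j → j ≤ p - 1 → ∑ i ∈ Icc 1 (p - j - 1), FF p l i =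
      (-1) ^ l * ∑ i ∈ Icc (j + 1) (p - 1), FF p l i := by
    intro j h h'
    rw [mul_sum]
    refine sum_nbij' (fun i => p - i) (fun i => p - i) ?_ ?_ ?_ ?_ ?_ <;>
      simp only [mem_Icc] <;> intro i hi
    · omega
    · omega
    · omega
    · omega
    · rw [← FF_neg (by omega), show p - (p - i) = i by omega]
  have r2 : ∀ j, 1 ≤ j → j ≤ p - 1 → ∑ i ∈ Icc (p - j + 1) (p - 1), FF p n i =
      (-1) ^ n * ∑ i ∈ Icc 1 (j - 1), FF p n i := by
    intro j h h'
    rw [mul_sum]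
    refine sum_nbij' (fun i => p - i) (fun i => p - i) ?_ ?_ ?_ ?_ ?_ <;>
      simp only [mem_Icc] <;> intro i hi
    · omega
    · omega
    · omega
    · omega
    · rw [← FF_neg (by omega), show p - (p - i) = i by omega]
  have sg : (-1 : ZMod p) ^ l * (-1) ^ m * (-1) ^ n = -1 := by
    rw [← pow_add, ← pow_add, hw.neg_one_pow]
  rw [key]
  unfold TT
  rw [← sum_neg_distrib]
  refine sum_nbij' (fun i => p - i) (fun i => p - i) ?_ ?_ ?_ ?_ ?_ <;>
    simp only [mem_Icc] <;> intro i hi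
  · omega
  · omega
  · omega
  · omega
  · have q1 := r1 (p - i) (by omega) (by omega)
    have q2 := r2 (p - i) (by omega) (by omega)
    rw [show p - (p - i) = i by omega] at q1 q2
    rw [q1, q2, FF_neg (by omega)]
    have sm : ((-1 : ZMod p) ^ m) * (-1) ^ m = 1 := by rw [← mul_pow]; simp
    generalize ∑ i ∈ Icc (p - i + 1) (p - 1), FF p l i = A
    generalize ∑ i ∈ Icc 1 (p - i - 1), FF p n i = B
    linear_combination (FF p m i * A * B * (-1) ^ m) * sg -
      (FF p m i * A * B * (-1) ^ l * (-1) ^ n) * sm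

end red

/-- Theorem `thm:FMZVdepth3superbity1`.
For positive integers `l, m, n` with `w = l + m + n` odd and all sufficiently
large primes `p`:
`-H_{p-1}(l,m,n) ≡ H⋆_{p-1}(l,m,n) ≡ [(-1)^l C(w,l) - (-1)^n C(w,n)] B_{p-w}/(2w) (mod p)`. -/
theorem depth_three_fmzv (l m n : ℕ) (hl : 0 < l) (hm : 0 < m) (hn : 0 < n)
    (hw : Odd (l + m + n)) :
    ∃ N, ∀ p ≥ N, Nat.Prime p →
      RatModEq p 1 (-(AMHS (p - 1) [(l, (1 : ℚ)), (m, (1 : ℚ)), (n, (1 : ℚ))]))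
        (((-1 : ℚ) ^ l * ((l + m + n).choose l : ℚ) - (-1 : ℚ) ^ n * ((l + m + n).choose n : ℚ)) *
          (bernoulli (p - (l + m + n)) / (2 * ((l + m + n : ℕ) : ℚ)))) ∧
      RatModEq p 1 (AMHSstar (p - 1) [(l, (1 : ℚ)), (m, (1 : ℚ)), (n, (1 : ℚ))])
        (((-1 : ℚ) ^ l * ((l + m + n).choose l : ℚ) - (-1 : ℚ) ^ n * ((l + m + n).choose n : ℚ)) *
          (bernoulli (p - (l + m + n)) / (2 * ((l + m + n : ℕ) : ℚ)))) := by
  refine ⟨l + m + n + 3, fun p hp hpp => ?_⟩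
  haveI : Fact p.Prime := ⟨hpp⟩
  have hB : ∀ t, t + 1 < p → ∃ z, Red p (bernoulli t) z := fun t ht => exists_red_bernoulli t ht
  choose! β hβ using hB
  have d1 := DD_eq hβ (a := l + m) (b := n) (by omega) hn (by omega)
  have d2 := DD_eq hβ (a := l) (b := m + n) hl (by omega) (by omega)
  have s1 := S_expand (p := p) l m n hl (by omega)
  have s2 := S_refl (p := p) l m n hl hn (by omega) hw
  have h2 : (2 : ZMod p) ≠ 0 := by
    exact_mod_cast natCast_ne_zero_of_lt (p := p) (k := 2) (by omega) (by omega)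
  have hw0 : ((l + m + n : ℕ) : ZMod p) ≠ 0 := natCast_ne_zero_of_lt (by omega) (by omega)
  have h2w : (2 * ((l + m + n : ℕ) : ZMod p)) ≠ 0 := mul_ne_zero h2 hw0
  rw [← add_assoc] at d2
  rw [Nat.choose_symm_add] at d1
  have sg : (-1 : ZMod p) ^ (l + m) = - (-1) ^ n := by
    have h1 : (-1 : ZMod p) ^ (l + m) * (-1) ^ n = -1 := by rw [← pow_add, hw.neg_one_pow]
    have h3 : (-1 : ZMod p) ^ n * (-1) ^ n = 1 := by rw [← mul_pow]; simp
    linear_combination (-1 : ZMod p) ^ n * h1 - (-1 : ZMod p) ^ (l + m) * h3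
  rw [sg] at d1
  have rr : Red p (((-1 : ℚ) ^ l * ((l + m + n).choose l : ℚ) -
      (-1 : ℚ) ^ n * ((l + m + n).choose n : ℚ)) *
          (bernoulli (p - (l + m + n)) / (2 * ((l + m + n : ℕ) : ℚ))))
      (((-1) ^ l * ((l + m + n).choose l : ZMod p) - (-1) ^ n * ((l + m + n).choose n : ZMod p)) *
        (β (p - (l + m + n)) * (2 * ((l + m + n : ℕ) : ZMod p))⁻¹)) := by
    rw [div_eq_mul_inv]
    have r2 : Red p 2 2 := by exact_mod_cast Red.natCast (p := p) 2
    exact (((Red.one.neg.pow l).mul (Red.natCast _)).sub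
      ((Red.one.neg.pow n).mul (Red.natCast _))).mul
      ((hβ _ (by omega)).mul ((r2.mul (Red.natCast _)).inv h2w))
  have hS : SS p l m n = (((-1) ^ l * ((l + m + n).choose l : ZMod p) -
      (-1) ^ n * ((l + m + n).choose n : ZMod p)) *
        (β (p - (l + m + n)) * (2 * ((l + m + n : ℕ) : ZMod p))⁻¹)) := by
    rw [← mul_assoc, eq_mul_inv_iff_mul_eq₀ h2w]
    linear_combination ((l + m + n : ℕ) : ZMod p) * (s1 + s2) + d1 + d2
  rw [← hS] at rr
  refine ⟨?_, (red_S l m n).modEq rr⟩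
  have := (red_T (p := p) l m n).neg
  rw [← s2] at this
  exact this.modEq rr
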